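/- arXiv:2102.12628 — 4 statements merged into one kernel-verified Lean document; each statement's English description precedes it below -/
import Mathlib

section
/- Let X = {1,...,n} be a finite state space, N ≥ 1 a time horizon, and for each t ∈ {0,...,N−1} let m_t(i,j) ≥ 0 be given weights. Let ν_0 and ν_N be probability vectors on X. Suppose there exist nonnegative functions φ and φ̂ on {0,...,N}×X, with φ(t,i) > 0 for all t and i, satisfying the Schrödinger system: φ(t,i) = Σ_j m_t(i,j)·φ(t+1,j) and φ̂(t+1,j) = Σ_i m_t(i,j)·φ̂(t,i) for all 0 ≤ t ≤ N−1, together with the boundary conditions φ(0,i)·φ̂(0,i) = ν_0(i) and φ(N,i)·φ̂(N,i) = ν_N(i) for all i. Define π*_t(i,j) := m_t(i,j)·φ(t+1,j)/φ(t,i). Then each π*_t is a row-stochastic matrix; the flow p* defined by p*_0 = ν_0 and p*_{t+1}(j) = Σ_i p*_t(i)·π*_t(i,j) satisfies p*_N = ν_N; and the pair (p*, π*) minimizes the functional Σ_{t=0}^{N−1} Σ_i p_t(i)·D(π_t(i,·) ‖ m_t(i,·)) over all pairs (p, π) where each π_t is row-stochastic, p_{t+1}(j) = Σ_i p_t(i)·π_t(i,j)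 for all t, p_0 = ν_0, and p_N = ν_N. -/
/-- Relative entropy (Kullback–Leibler divergence) between two nonnegative
vectors on a finite index set, with the convention `0·log 0 = 0` and
value `+∞` when the support condition fails. -/
noncomputable def relEnt {ι : Type*} [Fintype ι] (u v : ι → ℝ) : EReal :=
  open Classical in
  if ∀ j, v j = 0 → u j = 0 then ((∑ j, u j * Real.log (u j / v j) : ℝ) : EReal) else ⊤

/-- The flow of one-time marginals generated by initial distribution `ν₀`
and transition mechanism `π`. -/
noncomputable def flow {n : ℕ} (ν₀ : Fin n → ℝ) (π : ℕ → Fin n → Fin n → ℝ) :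
    ℕ → Fin n → ℝ
  | 0 => ν₀
  | (t + 1) => fun j => ∑ i, flow ν₀ π t i * π t i j

/-- Gibbs' variational inequality for the relative entropy with respect to an unnormalized
nonnegative vector `v`, tested against `log ψ`. -/
theorem le_relEnt_of_sum_mul_eq {ι : Type*} [Fintype ι] {u v ψ : ι → ℝ} {c : ℝ}
    (hu : ∀ j, 0 ≤ u j) (hu1 : ∑ j, u j = 1) (hv : ∀ j, 0 ≤ v j) (hψ : ∀ j, 0 < ψ j)
    (hc : 0 < c) (hcv : c = ∑ j, v j * ψ j) :
    ((∑ j, u j * Real.log (ψ j) - Real.log c : ℝ) : EReal) ≤ relEnt u v := by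
  unfold relEnt
  split_ifs with hsupp
  · rw [EReal.coe_le_coe_iff]
    have hterm : ∀ j, u j * Real.log (ψ j) - u j * Real.log c + u j - v j * ψ j / c ≤
        u j * Real.log (u j / v j) := by
      intro j
      rcases (hu j).eq_or_lt with h0 | hpos
      · have : 0 ≤ v j * ψ j / c := div_nonneg (mul_nonneg (hv j) (hψ j).le) hc.le
        simp [← h0, this]
      · have hvj : 0 < v j := lt_of_le_of_ne (hv j) fun h => hpos.ne' (hsupp j h.symm)
        have hlog := Real.log_le_sub_one_of_pos (x := v j * ψ j / (c * u j))
          (div_pos (mul_pos hvj (hψ j)) (mul_pos hc hpos))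
        rw [Real.log_div (mul_pos hvj (hψ j)).ne' (mul_pos hc hpos).ne',
          Real.log_mul hvj.ne' (hψ j).ne', Real.log_mul hc.ne' hpos.ne'] at hlog
        rw [Real.log_div hpos.ne' hvj.ne']
        have hmul := mul_le_mul_of_nonneg_left hlog hpos.le
        have hcancel : u j * (v j * ψ j / (c * u j) - 1) = v j * ψ j / c - u j := by
          field_simp
        rw [hcancel] at hmul
        linarith
    have hsum := Finset.sum_le_sum fun j (_ : j ∈ Finset.univ) => hterm j
    rw [Finset.sum_sub_distrib, Finset.sum_add_distrib, Finset.sum_sub_distrib,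
      ← Finset.sum_mul, ← Finset.sum_div, ← hcv, hu1, div_self hc.ne'] at hsum
    linarith
  · exact le_top

/-- The Gibbs bound `le_relEnt_of_sum_mul_eq` is attained at the tilted probability vector
`v j * ψ j / c`. -/
theorem relEnt_tilted {ι : Type*} [Fintype ι] {u v ψ : ι → ℝ} {c : ℝ}
    (hu : ∀ j, u j = v j * ψ j / c) (hψ : ∀ j, 0 < ψ j) (hc : 0 < c)
    (hcv : c = ∑ j, v j * ψ j) :
    relEnt u v = ((∑ j, u j * Real.log (ψ j) - Real.log c : ℝ) : EReal) := by
  have hu1 : ∑ j, u j = 1 := by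
    simp_rw [hu]
    rw [← Finset.sum_div, ← hcv, div_self hc.ne']
  unfold relEnt
  rw [if_pos fun j h => by simp [hu, h]]
  congr 1
  rw [← one_mul (Real.log c), ← hu1, Finset.sum_mul, ← Finset.sum_sub_distrib]
  refine Finset.sum_congr rfl fun j _ => ?_
  rcases eq_or_ne (v j) 0 with h | h
  · simp [hu, h]
  · have hratio : u j / v j = ψ j / c := by
      rw [hu]
      field_simp
    rw [hratio, Real.log_div (hψ j).ne' hc.ne', mul_sub]

/-- The expected increments of a time-dependent function along a flow of marginals telescope. -/
theorem sum_expected_increment {ι : Type*} [Fintype ι] {N : ℕ} {p : ℕ → ι → ℝ}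
    {π : ℕ → ι → ι → ℝ} (hp : ∀ t, t < N → ∀ j, p (t + 1) j = ∑ i, p t i * π t i j)
    (f : ℕ → ι → ℝ) :
    ∑ t ∈ Finset.range N, ∑ i, p t i * (∑ j, π t i j * f (t + 1) j - f t i) =
      ∑ i, p N i * f N i - ∑ i, p 0 i * f 0 i := by
  rw [← Finset.sum_range_sub (fun t => ∑ i, p t i * f t i)]
  refine Finset.sum_congr rfl fun t ht => ?_
  simp_rw [mul_sub, Finset.sum_sub_distrib, hp t (Finset.mem_range.mp ht), Finset.sum_mul,
    Finset.mul_sum, mul_assoc]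
  rw [Finset.sum_comm]

theorem EReal.coe_sum_real {ι : Type*} (s : Finset ι) (f : ι → ℝ) :
    ((∑ i ∈ s, f i : ℝ) : EReal) = ∑ i ∈ s, (f i : EReal) :=
  map_sum (⟨⟨Real.toEReal, EReal.coe_zero⟩, EReal.coe_add⟩ : ℝ →+ EReal) f s


theorem schroedinger_bridge_optimality
    (n N : ℕ) (hN : 1 ≤ N)
    (m : ℕ → Fin n → Fin n → ℝ)
    (hm : ∀ t, t < N → ∀ i j, 0 ≤ m t i j)
    (ν₀ νN : Fin n → ℝ)
    (hν₀ : (∀ i, 0 ≤ ν₀ i) ∧ ∑ i, ν₀ i = 1)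
    (hνN : (∀ i, 0 ≤ νN i) ∧ ∑ i, νN i = 1)
    (φ φhat : ℕ → Fin n → ℝ)
    (hφpos : ∀ t, t ≤ N → ∀ i, 0 < φ t i)
    (hφhatnonneg : ∀ t, t ≤ N → ∀ i, 0 ≤ φhat t i)
    (hφ : ∀ t, t < N → ∀ i, φ t i = ∑ j, m t i j * φ (t + 1) j)
    (hφhat : ∀ t, t < N → ∀ j, φhat (t + 1) j = ∑ i, m t i j * φhat t i)
    (hbc0 : ∀ i, φ 0 i * φhat 0 i = ν₀ i)
    (hbcN : ∀ i, φ N i * φhat N i = νN i)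
    (πstar : ℕ → Fin n → Fin n → ℝ)
    (hπstar : ∀ t i j, πstar t i j = m t i j * φ (t + 1) j / φ t i) :
    -- (a) each `πstar t`, `t < N`, is a row-stochastic matrix
    (∀ t, t < N → ∀ i, (∀ j, 0 ≤ πstar t i j) ∧ ∑ j, πstar t i j = 1) ∧
    -- (b) the induced flow started at `ν₀` reaches `νN` at time `N`
    flow ν₀ πstar N = νN ∧
    -- (c) `(flow ν₀ πstar, πstar)` minimizes the entropic cost among all
    --     feasible pairs `(p, π)`
    (∀ (p : ℕ → Fin n → ℝ) (π : ℕ → Fin n → Fin n → ℝ),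
      (∀ t, t < N → ∀ i, (∀ j, 0 ≤ π t i j) ∧ ∑ j, π t i j = 1) →
      p 0 = ν₀ →
      (∀ t, t < N → ∀ j, p (t + 1) j = ∑ i, p t i * π t i j) →
      p N = νN →
      ∑ t ∈ Finset.range N, ∑ i,
          ((flow ν₀ πstar t i : ℝ) : EReal) * relEnt (πstar t i) (m t i) ≤
        ∑ t ∈ Finset.range N, ∑ i,
          ((p t i : ℝ) : EReal) * relEnt (π t i) (m t i)) := by
  have hφpos' : ∀ t, t < N → ∀ j, 0 < φ (t + 1) j := fun t ht => hφpos (t + 1) ht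
  have hflow : ∀ t, t ≤ N → ∀ i, flow ν₀ πstar t i = φ t i * φhat t i := by
    intro t
    induction t with
    | zero => exact fun _ i => (hbc0 i).symm
    | succ t ih =>
      intro ht j
      have ht' : t < N := ht
      simp only [flow]
      rw [hφhat t ht' j, Finset.mul_sum]
      refine Finset.sum_congr rfl fun i _ => ?_
      have := (hφpos t ht'.le i).ne'
      rw [ih ht'.le i, hπstar]
      field_simp
  have hflowN : flow ν₀ πstar N = νN := funext fun i => (hflow N le_rfl i).trans (hbcN i)
  refine ⟨fun t ht i => ⟨fun j => ?_, ?_⟩, hflowN, ?_⟩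
  · rw [hπstar]
    exact div_nonneg (mul_nonneg (hm t ht i j) (hφpos' t ht j).le) (hφpos t ht.le i).le
  · simp_rw [hπstar]
    rw [← Finset.sum_div, ← hφ t ht i, div_self (hφpos t ht.le i).ne']
  · intro p π hπ hp0 hp hpN
    have hpnonneg : ∀ t, t ≤ N → ∀ i, 0 ≤ p t i := by
      intro t
      induction t with
      | zero => exact fun _ i => hp0 ▸ hν₀.1 i
      | succ t ih =>
        intro ht j
        rw [hp t ht j]
        exact Finset.sum_nonneg fun i _ =>
          mul_nonneg (ih (Nat.le_of_succ_le ht) i) ((hπ t ht i).1 j)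
    let f : ℕ → Fin n → ℝ := fun t i => Real.log (φ t i)
    calc ∑ t ∈ Finset.range N, ∑ i,
          ((flow ν₀ πstar t i : ℝ) : EReal) * relEnt (πstar t i) (m t i)
        = ((∑ t ∈ Finset.range N, ∑ i, flow ν₀ πstar t i *
            (∑ j, πstar t i j * f (t + 1) j - f t i) : ℝ) : EReal) := by
          rw [EReal.coe_sum_real]
          refine Finset.sum_congr rfl fun t ht => ?_
          rw [EReal.coe_sum_real]
          refine Finset.sum_congr rfl fun i _ => ?_
          have ht' := Finset.mem_range.mp ht
          rw [relEnt_tilted (hπstar t i) (hφpos' t ht') (hφpos t ht'.le i) (hφ t ht' i),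
            ← EReal.coe_mul]
      _ = ((∑ t ∈ Finset.range N, ∑ i, p t i *
            (∑ j, π t i j * f (t + 1) j - f t i) : ℝ) : EReal) := by
          rw [sum_expected_increment hp f,
            sum_expected_increment (p := flow ν₀ πstar) (fun _ _ _ => rfl) f,
            hflowN, hpN, hp0]
          rfl
      _ ≤ _ := by
          rw [EReal.coe_sum_real]
          refine Finset.sum_le_sum fun t ht => ?_
          rw [EReal.coe_sum_real]
          refine Finset.sum_le_sum fun i _ => ?_
          have ht' := Finset.mem_range.mp ht
          rw [EReal.coe_mul]
          exact mul_le_mul_of_nonneg_left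
            (le_relEnt_of_sum_mul_eq (hπ t ht' i).1 (hπ t ht' i).2 (hm t ht' i)
              (hφpos' t ht') (hφpos t ht'.le i) (hφ t ht' i))
            (EReal.coe_nonneg.mpr (hpnonneg t ht'.le i))
end

section
/- Let M = (m_{ij}) be an n×n matrix with nonnegative entries and π a strictly positive probability vector on {1,...,n}. Suppose φ_0, φ_1 ∈ ℝ^n are strictly positive vectors satisfying φ_0 = M·φ_1 and (π/φ_1) = Mᵀ·(π/φ_0) (division componentwise), and define Π*_{ij} := m_{ij}·φ_1(j)/φ_0(i). Then Π* minimizes the objective Σ_i D(Π_{i·} ‖ m_{i·})·π(i) over all row-stochastic matrices Π = (π_{ij}) satisfying Πᵀ·π = π. -/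
/-- The Gibbs inequality for nonnegative vectors of equal mass, tested against the exponential tilt
`j ↦ v j * w j` of `v`. -/
theorem sum_mul_log_le_relEnt {ι : Type*} [Fintype ι] {u v w : ι → ℝ}
    (hu : ∀ j, 0 ≤ u j) (hv : ∀ j, 0 ≤ v j) (hw : ∀ j, 0 < w j)
    (hmass : ∑ j, v j * w j = ∑ j, u j) :
    ((∑ j, u j * Real.log (w j) : ℝ) : EReal) ≤ relEnt u v := by
  unfold relEnt
  split_ifs with hsupp
  · rw [EReal.coe_le_coe_iff]
    have hterm : ∀ j, u j * Real.log (w j) + (u j - v j * w j) ≤ u j * Real.log (u j / v j) := by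
      intro j
      rcases (hu j).eq_or_lt with h0 | hupos
      · simpa [← h0] using mul_nonneg (hv j) (hw j).le
      · have hvpos : 0 < v j := (hv j).lt_of_ne fun h => hupos.ne' (hsupp j h.symm)
        have hlog := Real.log_le_sub_one_of_pos (div_pos (mul_pos hvpos (hw j)) hupos)
        rw [Real.log_div (mul_pos hvpos (hw j)).ne' hupos.ne',
          Real.log_mul hvpos.ne' (hw j).ne'] at hlog
        rw [Real.log_div hupos.ne' hvpos.ne']
        have hmul := mul_le_mul_of_nonneg_left hlog hupos.le
        have hcancel : u j * (v j * w j / u j - 1) = v j * w j - u j := by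
          field_simp
        linarith
    have hsum := Finset.sum_le_sum fun j (_ : j ∈ Finset.univ) => hterm j
    rw [Finset.sum_add_distrib, Finset.sum_sub_distrib, hmass] at hsum
    linarith
  · exact le_top

theorem relEnt_mul_left {ι : Type*} [Fintype ι] (v w : ι → ℝ) :
    relEnt (fun j => v j * w j) v = ((∑ j, v j * w j * Real.log (w j) : ℝ) : EReal) := by
  unfold relEnt
  rw [if_pos fun j hj => by simp [hj]]
  congr 1
  refine Finset.sum_congr rfl fun j _ => ?_
  rcases eq_or_ne (v j) 0 with h | h
  · simp [h]
  · rw [mul_div_cancel_left₀ _ h]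

/-- The average of `log (b j / a i)` under a coupling depends only on its marginals. -/
theorem sum_mul_log_div_of_stationary {ι : Type*} [Fintype ι] {P : Matrix ι ι ℝ} {p a b : ι → ℝ}
    (ha : ∀ i, 0 < a i) (hb : ∀ j, 0 < b j) (hrow : ∀ i, ∑ j, P i j = 1)
    (hstat : P.transpose.mulVec p = p) :
    ∑ i, (∑ j, P i j * Real.log (b j / a i)) * p i =
      ∑ j, p j * Real.log (b j) - ∑ i, p i * Real.log (a i) := by
  have hinner : ∀ i, (∑ j, P i j * Real.log (b j / a i)) * p i =
      ∑ j, P i j * p i * Real.log (b j) - p i * Real.log (a i) := by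
    intro i
    calc (∑ j, P i j * Real.log (b j / a i)) * p i
        = ∑ j, (P i j * p i * Real.log (b j) - P i j * (p i * Real.log (a i))) := by
          rw [Finset.sum_mul]
          refine Finset.sum_congr rfl fun j _ => ?_
          rw [Real.log_div (hb j).ne' (ha i).ne']
          ring
      _ = _ := by rw [Finset.sum_sub_distrib, ← Finset.sum_mul, hrow, one_mul]
  simp_rw [hinner]
  rw [Finset.sum_sub_distrib, Finset.sum_comm]
  congr 1
  refine Finset.sum_congr rfl fun j _ => ?_
  rw [← Finset.sum_mul]
  congr 1
  exact congrFun hstat j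

theorem one_step_schroedinger_minimizes_relEnt_rate
    (n : ℕ)
    (M : Matrix (Fin n) (Fin n) ℝ) (hM : ∀ i j, 0 ≤ M i j)
    (π : Fin n → ℝ) (hπpos : ∀ i, 0 < π i) (hπsum : ∑ i, π i = 1)
    (φ₀ φ₁ : Fin n → ℝ)
    (hφ₀pos : ∀ i, 0 < φ₀ i) (hφ₁pos : ∀ i, 0 < φ₁ i)
    (h₁ : φ₀ = M.mulVec φ₁)
    (h₂ : (fun j => π j / φ₁ j) = M.transpose.mulVec (fun i => π i / φ₀ i))
    (Pstar : Matrix (Fin n) (Fin n) ℝ)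
    (hPstar : ∀ i j, Pstar i j = M i j * φ₁ j / φ₀ i) :
    ∀ Pmat : Matrix (Fin n) (Fin n) ℝ,
      (∀ i j, 0 ≤ Pmat i j) →
      (∀ i, ∑ j, Pmat i j = 1) →
      Pmat.transpose.mulVec π = π →
      ∑ i, relEnt (Pstar i) (M i) * ((π i : ℝ) : EReal) ≤
        ∑ i, relEnt (Pmat i) (M i) * ((π i : ℝ) : EReal) := by
  intro Pmat hnonneg hrow hstat
  have hPrw : ∀ i, Pstar i = fun j => M i j * (φ₁ j / φ₀ i) := fun i => by
    ext j
    rw [hPstar, mul_div_assoc]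
  have hProw : ∀ i, ∑ j, Pstar i j = 1 := by
    intro i
    simp_rw [hPstar]
    rw [← Finset.sum_div, div_eq_one_iff_eq (hφ₀pos i).ne']
    exact (congrFun h₁ i).symm
  have hPstat : Pstar.transpose.mulVec π = π := by
    ext j
    have hj : π j / φ₁ j = ∑ i, M i j * (π i / φ₀ i) := congrFun h₂ j
    rw [div_eq_iff (hφ₁pos j).ne', Finset.sum_mul] at hj
    rw [hj]
    change ∑ i, Pstar i j * π i = _
    refine Finset.sum_congr rfl fun i _ => ?_
    rw [hPstar]
    ring
  have hstar : ∀ i, relEnt (Pstar i) (M i) =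
      ((∑ j, Pstar i j * Real.log (φ₁ j / φ₀ i) : ℝ) : EReal) := by
    intro i
    rw [hPrw, relEnt_mul_left]
  have hbound : ∀ i, ((∑ j, Pmat i j * Real.log (φ₁ j / φ₀ i) : ℝ) : EReal) ≤
      relEnt (Pmat i) (M i) := by
    intro i
    refine sum_mul_log_le_relEnt (hnonneg i) (hM i)
      (fun j => div_pos (hφ₁pos j) (hφ₀pos i)) ?_
    rw [hrow, ← hProw i, hPrw]
  calc ∑ i, relEnt (Pstar i) (M i) * ((π i : ℝ) : EReal)
      = ((∑ i, (∑ j, Pstar i j * Real.log (φ₁ j / φ₀ i)) * π i : ℝ) : EReal) := by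
        simp_rw [hstar, ← EReal.coe_mul]
        exact (EReal.coe_sum_real _ _).symm
    _ = ((∑ i, (∑ j, Pmat i j * Real.log (φ₁ j / φ₀ i)) * π i : ℝ) : EReal) := by
        rw [sum_mul_log_div_of_stationary hφ₀pos hφ₁pos hProw hPstat,
          sum_mul_log_div_of_stationary hφ₀pos hφ₁pos hrow hstat]
    _ = ∑ i, ((∑ j, Pmat i j * Real.log (φ₁ j / φ₀ i) : ℝ) : EReal) * ((π i : ℝ) : EReal) := by
        simp_rw [← EReal.coe_mul]
        exact EReal.coe_sum_real _ _
    _ ≤ ∑ i, relEnt (Pmat i) (M i) * ((π i : ℝ) : EReal) :=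
        Finset.sum_le_sum fun i _ =>
          mul_le_mul_of_nonneg_right (hbound i) (EReal.coe_nonneg.2 (hπpos i).le)
end

section
/- Let M be an n×n matrix with nonnegative entries that is fully indecomposable, and suppose M is reversible with respect to a strictly positive vector μ, i.e., Diag(μ)·M = Mᵀ·Diag(μ). Let π be a strictly positive probability vector and let φ_0, φ_1 ∈ ℝ^n be strictly positive vectors satisfying the one-step Schrödinger system φ_0 = M·φ_1 and (π/φ_1) = Mᵀ·(π/φ_0) (division componentwise). Then the matrix Π* := Diag(φ_0)^{-1}·M·Diag(φ_1) is reversible with respect to π, i.e., Diag(π)·Π* = (Π*)ᵀ·Diag(π). -/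
/-- A square matrix `A` with nonnegative entries is *fully indecomposable* if
there are no permutation matrices `P`, `Q` such that `P⁻¹ * A * Q⁻¹` has the
block form `[[A₁₁, 0], [A₂₁, A₂₂]]` with nonvacuous square diagonal blocks;
equivalently, there are no permutations `σ`, `τ` of the indices and no
`0 < k < n` such that `A (σ i) (τ j) = 0` whenever `i < k ≤ j`. -/
def FullyIndecomposable {n : ℕ} (A : Matrix (Fin n) (Fin n) ℝ) : Prop :=
  ¬ ∃ (k : ℕ) (_ : 0 < k) (_ : k < n) (σ τ : Equiv.Perm (Fin n)),
      ∀ i j : Fin n, (i : ℕ) < k → k ≤ (j : ℕ) → A (σ i) (τ j) = 0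

/-- A function that is harmonic for a symmetric nonnegative weight is constant along every edge of
nonzero weight. -/
theorem weight_mul_sub_eq_zero_of_harmonic {ι : Type*} [Fintype ι] {W : ι → ι → ℝ} {r : ι → ℝ}
    (hW : ∀ i j, 0 ≤ W i j) (hsymm : ∀ i j, W i j = W j i)
    (hr : ∀ i, ∑ j, W i j * (r i - r j) = 0) (i j : ι) : W i j * (r i - r j) = 0 := by
  have hleft : ∑ i, ∑ j, W i j * (r i - r j) * r i = 0 := by
    simp_rw [← Finset.sum_mul, hr, zero_mul, Finset.sum_const_zero]
  have hright : ∑ i, ∑ j, W i j * (r i - r j) * r j = 0 := by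
    rw [Finset.sum_comm, ← neg_eq_zero, ← Finset.sum_neg_distrib, ← hleft]
    refine Finset.sum_congr rfl fun i _ => ?_
    rw [← Finset.sum_neg_distrib]
    refine Finset.sum_congr rfl fun j _ => ?_
    rw [hsymm j i]
    ring
  have henergy : ∑ i, ∑ j, W i j * (r i - r j) ^ 2 = 0 := by
    rw [← sub_eq_zero.mpr (hleft.trans hright.symm), ← Finset.sum_sub_distrib]
    refine Finset.sum_congr rfl fun i _ => ?_
    rw [← Finset.sum_sub_distrib]
    exact Finset.sum_congr rfl fun j _ => by ring
  have hnonneg : ∀ i j, 0 ≤ W i j * (r i - r j) ^ 2 := fun i j => mul_nonneg (hW i j) (sq_nonneg _)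
  have hrow := (Finset.sum_eq_zero_iff_of_nonneg
    fun i _ => Finset.sum_nonneg fun j _ => hnonneg i j).mp henergy i (Finset.mem_univ i)
  have hij := (Finset.sum_eq_zero_iff_of_nonneg fun j _ => hnonneg i j).mp hrow j
    (Finset.mem_univ j)
  rcases mul_eq_zero.mp hij with h | h
  · rw [h, zero_mul]
  · rw [pow_eq_zero_iff two_ne_zero |>.mp h, mul_zero]

theorem reversible_prior_gives_reversible_solution
    (n : ℕ)
    (M : Matrix (Fin n) (Fin n) ℝ) (hM : ∀ i j, 0 ≤ M i j)
    (hMfi : FullyIndecomposable M)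
    (μ : Fin n → ℝ) (hμpos : ∀ i, 0 < μ i)
    -- reversibility of the prior:  Diag(μ)·M = Mᵀ·Diag(μ)
    (hrev : Matrix.diagonal μ * M = M.transpose * Matrix.diagonal μ)
    (π : Fin n → ℝ) (hπpos : ∀ i, 0 < π i) (hπsum : ∑ i, π i = 1)
    (φ₀ φ₁ : Fin n → ℝ)
    (hφ₀pos : ∀ i, 0 < φ₀ i) (hφ₁pos : ∀ i, 0 < φ₁ i)
    (h₁ : φ₀ = M.mulVec φ₁)
    (h₂ : (fun j => π j / φ₁ j) = M.transpose.mulVec (fun i => π i / φ₀ i))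
    (Pstar : Matrix (Fin n) (Fin n) ℝ)
    (hPstar : Pstar = (Matrix.diagonal φ₀)⁻¹ * M * Matrix.diagonal φ₁) :
    Matrix.diagonal π * Pstar = Pstar.transpose * Matrix.diagonal π := by
  have hS : ∀ i j, μ i * M i j = μ j * M j i := fun i j => by
    have h := congrFun (congrFun hrev i) j
    rw [Matrix.diagonal_mul, Matrix.mul_diagonal, Matrix.transpose_apply] at h
    rw [h, mul_comm]
  have hrowsum : ∀ i, φ₀ i = ∑ j, M i j * φ₁ j := fun i => congrFun h₁ i
  have hcolsum : ∀ j, π j / φ₁ j = ∑ i, M i j * (π i / φ₀ i) := fun j => congrFun h₂ j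
  have hinv : (Matrix.diagonal φ₀)⁻¹ = Matrix.diagonal fun i => (φ₀ i)⁻¹ := by
    refine Matrix.inv_eq_left_inv ?_
    rw [Matrix.diagonal_mul_diagonal, ← Matrix.diagonal_one]
    exact congrArg Matrix.diagonal (funext fun i => inv_mul_cancel₀ (hφ₀pos i).ne')
  have hharm : ∀ i, ∑ j, φ₁ i * (μ i * M i j) * φ₁ j *
      (π i / (φ₀ i * μ i * φ₁ i) - π j / (φ₀ j * μ j * φ₁ j)) = 0 := fun i => by
    have hterm : ∀ j, φ₁ i * (μ i * M i j) * φ₁ j *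
        (π i / (φ₀ i * μ i * φ₁ i) - π j / (φ₀ j * μ j * φ₁ j)) =
        π i / φ₀ i * (M i j * φ₁ j) - φ₁ i * (M j i * (π j / φ₀ j)) := fun j => by
      have := (hφ₀pos i).ne'
      have := (hφ₀pos j).ne'
      have := (hφ₁pos i).ne'
      have := (hφ₁pos j).ne'
      have := (hμpos i).ne'
      have := (hμpos j).ne'
      rw [mul_sub]
      congr 1
      · field_simp
      · rw [hS i j]
        field_simp
    rw [Finset.sum_congr rfl fun j _ => hterm j, Finset.sum_sub_distrib, ← Finset.mul_sum,
      ← Finset.mul_sum, ← hrowsum, ← hcolsum, div_mul_cancel₀ _ (hφ₀pos i).ne',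
      mul_div_cancel₀ _ (hφ₁pos i).ne', sub_self]
  ext i j
  have hedge := weight_mul_sub_eq_zero_of_harmonic
    (W := fun i j => φ₁ i * (μ i * M i j) * φ₁ j)
    (r := fun i => π i / (φ₀ i * μ i * φ₁ i))
    (fun i j => mul_nonneg (mul_nonneg (hφ₁pos i).le (mul_nonneg (hμpos i).le (hM i j)))
      (hφ₁pos j).le)
    (fun i j => by rw [hS i j]; ring) hharm i j
  simp only [hPstar, hinv, Matrix.diagonal_mul, Matrix.mul_diagonal, Matrix.transpose_apply]
  have := (hφ₀pos i).ne'
  have := (hφ₀pos j).ne'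
  have := (hφ₁pos i).ne'
  have := (hφ₁pos j).ne'
  have := (hμpos i).ne'
  have := (hμpos j).ne'
  calc π i * ((φ₀ i)⁻¹ * M i j * φ₁ j)
      = φ₁ i * (μ i * M i j) * φ₁ j * (π i / (φ₀ i * μ i * φ₁ i)) := by field_simp
    _ = φ₁ i * (μ i * M i j) * φ₁ j * (π j / (φ₀ j * μ j * φ₁ j)) := by
      rw [← sub_eq_zero, ← mul_sub]
      exact hedge
    _ = (φ₀ j)⁻¹ * M j i * φ₁ i * π j := by
      rw [hS i j]
      field_simp
end

section
/- Let M be an n×n fully indecomposable matrix with nonnegative entries such that Σ := Diag(μ)·M is symmetric for a strictly positive vector μ, and let π be a strictly positive probability vector. Let φ_0, φ_1 ∈ ℝ^n be strictly positive vectors satisfying φ_0 = M·φ_1 and (π/φ_1) = Mᵀ·(π/φ_0) (division componentwise), and set φ̂_0 := π/φ_0 and φ̂_1 := π/φ_1. Then there exists a positive scalar c such that φ̂_0(i) = c·μ(i)·φ_1(i) and μ(i)·φ_0(i) = (1/c)·φ̂_1(i) for all i. -/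
/-- A nonempty set `T` of rows of a fully indecomposable matrix whose entries outside the columns
indexed by `T` vanish contains every index. -/
theorem FullyIndecomposable.eq_univ_of_invariant {n : ℕ} {A : Matrix (Fin n) (Fin n) ℝ}
    (hA : FullyIndecomposable A) (T : Finset (Fin n)) (hT : T.Nonempty)
    (h : ∀ i ∈ T, ∀ j ∉ T, A i j = 0) : T = Finset.univ := by
  classical
  by_contra hne
  have hlt : T.card < n := by
    simpa using Finset.card_lt_card (Finset.ssubset_univ_iff.mpr hne)
  have hcard : Fintype.card {i : Fin n // (i : ℕ) < T.card} = Fintype.card {i // i ∈ T} := by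
    rw [Fintype.card_coe, Fintype.card_subtype, Fin.card_filter_val_lt, min_eq_right hlt.le]
  let e := Fintype.equivOfCardEq hcard
  refine hA ⟨T.card, hT.card_pos, hlt, e.extendSubtype, e.extendSubtype, fun i j hi hj => ?_⟩
  exact h _ (e.extendSubtype_mem i hi) _ (e.extendSubtype_not_mem j (not_lt.mpr hj))

/-- Maximum principle: a function that is harmonic for the weights `A i j * w j` is constant if `A`
is nonnegative and fully indecomposable. -/
theorem FullyIndecomposable.harmonic_eq {n : ℕ} {A : Matrix (Fin n) (Fin n) ℝ}
    (hA : FullyIndecomposable A) (hA0 : ∀ i j, 0 ≤ A i j) {w r : Fin n → ℝ}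
    (hw : ∀ i, 0 < w i) (h : ∀ i, r i * ∑ j, A i j * w j = ∑ j, A i j * w j * r j)
    (i j : Fin n) : r i = r j := by
  obtain ⟨m, -, hm⟩ := Finset.exists_max_image Finset.univ r ⟨i, Finset.mem_univ i⟩
  have huniv : Finset.univ.filter (fun k => r k = r m) = Finset.univ := by
    refine hA.eq_univ_of_invariant _ ⟨m, by simp⟩ fun k hk l hl => ?_
    simp only [Finset.mem_filter, Finset.mem_univ, true_and] at hk hl
    have hsum : ∑ p, A k p * w p * (r m - r p) = 0 := by
      simp only [mul_sub, Finset.sum_sub_distrib, ← Finset.sum_mul]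
      rw [← h k, hk]
      ring
    have hzero := (Finset.sum_eq_zero_iff_of_nonneg fun p _ =>
      mul_nonneg (mul_nonneg (hA0 k p) (hw p).le)
        (sub_nonneg.mpr (hm p (Finset.mem_univ p)))).mp hsum l (Finset.mem_univ l)
    simpa [(hw l).ne', sub_eq_zero, Ne.symm hl] using hzero
  have hconst : ∀ k, r k = r m := by simpa [Finset.filter_eq_self] using huniv
  rw [hconst i, hconst j]

theorem schroedinger_system_symmetry_relation
    (n : ℕ)
    (M : Matrix (Fin n) (Fin n) ℝ) (hM : ∀ i j, 0 ≤ M i j)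
    (hMfi : FullyIndecomposable M)
    (μ : Fin n → ℝ) (hμpos : ∀ i, 0 < μ i)
    -- Σ := Diag(μ)·M is symmetric
    (hsym : (Matrix.diagonal μ * M).IsSymm)
    (π : Fin n → ℝ) (hπpos : ∀ i, 0 < π i) (hπsum : ∑ i, π i = 1)
    (φ₀ φ₁ : Fin n → ℝ)
    (hφ₀pos : ∀ i, 0 < φ₀ i) (hφ₁pos : ∀ i, 0 < φ₁ i)
    (h₁ : φ₀ = M.mulVec φ₁)
    (h₂ : (fun j => π j / φ₁ j) = M.transpose.mulVec (fun i => π i / φ₀ i)) :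
    ∃ c : ℝ, 0 < c ∧
      (∀ i, π i / φ₀ i = c * μ i * φ₁ i) ∧
      (∀ i, μ i * φ₀ i = (1 / c) * (π i / φ₁ i)) := by
  have hS : ∀ i j, μ j * M j i = μ i * M i j := fun i j => by
    simpa [Matrix.diagonal_mul] using hsym.apply i j
  have hn : n ≠ 0 := by
    rintro rfl
    simp at hπsum
  let r : Fin n → ℝ := fun i => π i / (φ₀ i * (μ i * φ₁ i))
  have hr : ∀ i, π i / φ₀ i = r i * μ i * φ₁ i := fun i => by
    have := (hφ₀pos i).ne'
    have := (hφ₁pos i).ne'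
    have := (hμpos i).ne'
    simp only [r]
    field_simp
  have hr' : ∀ i, π i / φ₁ i = r i * μ i * φ₀ i := fun i => by
    have := (hφ₀pos i).ne'
    have := (hφ₁pos i).ne'
    have := (hμpos i).ne'
    simp only [r]
    field_simp
  have hharm : ∀ i, r i * ∑ j, M i j * φ₁ j = ∑ j, M i j * φ₁ j * r j := fun i => by
    have hφ : φ₀ i = ∑ j, M i j * φ₁ j := congrFun h₁ i
    have hsum : π i / φ₁ i = ∑ j, M j i * (π j / φ₀ j) := congrFun h₂ i
    refine mul_left_cancel₀ (hμpos i).ne' ?_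
    rw [← hφ, ← mul_assoc, mul_comm (μ i), ← hr', hsum, Finset.mul_sum]
    refine Finset.sum_congr rfl fun j _ => ?_
    rw [hr]
    linear_combination (r j * φ₁ j) * hS i j
  let o : Fin n := ⟨0, Nat.pos_of_ne_zero hn⟩
  have hconst : ∀ i, r i = r o := fun i => hMfi.harmonic_eq hM hφ₁pos hharm i o
  have hpos : 0 < r o := div_pos (hπpos o) (mul_pos (hφ₀pos o) (mul_pos (hμpos o) (hφ₁pos o)))
  refine ⟨r o, hpos, fun i => by rw [hr, hconst], fun i => ?_⟩
  rw [hr', hconst i]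
  field_simp
end
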